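/- arXiv:1212.3684 — 2 statements merged into one kernel-verified Lean document; each statement's English description precedes it below -/
import Mathlib

section
/- Let Q, R be cubes with ℓ(Q) < ℓ(R), let c_Q be the center of Q, let (x,t) ∈ W_R = R × (ℓ(R)/2, ℓ(R)) and y ∈ Q. Then |s_t(x,y) − s_t(x,c_Q)| ≲ ℓ(Q)^{α/2} ℓ(R)^{α/2} / (D(Q,R)^α · sup_{z ∈ Q ∪ R} λ(z, D(Q,R))), where D(Q,R) = ℓ(Q) + ℓ(R) + d(Q,R). -/
open MeasureTheory Set

noncomputable section

/-- The axis-parallel cube in `ℝⁿ` (with the `ℓ^∞` metric) with center `c` and sidelength `L`,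
realized as the closed `ℓ^∞` ball of radius `L/2`. -/
def Cube {n : ℕ} (c : Fin n → ℝ) (L : ℝ) : Set (Fin n → ℝ) :=
  Metric.closedBall c (L / 2)

/-- The `ℓ^∞` distance between two sets in `ℝⁿ`. -/
def sdist {n : ℕ} (A B : Set (Fin n → ℝ)) : ℝ :=
  sInf (Set.image2 dist A B)

lemma dist_le_of_mem_cube {n : ℕ} {c x y : Fin n → ℝ} {L : ℝ} (hx : x ∈ Cube c L)
    (hy : y ∈ Cube c L) : dist x y ≤ L := by
  have hx' : dist x c ≤ L / 2 := hx
  have hy' : dist y c ≤ L / 2 := hy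
  linarith [dist_triangle_right x y c]

lemma sdist_nonneg {n : ℕ} (A B : Set (Fin n → ℝ)) : 0 ≤ sdist A B :=
  Real.sInf_nonneg (by rintro _ ⟨a, _, b, _, rfl⟩; exact dist_nonneg)

lemma sdist_le_dist {n : ℕ} {A B : Set (Fin n → ℝ)} {a b : Fin n → ℝ} (ha : a ∈ A)
    (hb : b ∈ B) : sdist A B ≤ dist a b :=
  csInf_le ⟨0, by rintro _ ⟨a, _, b, _, rfl⟩; exact dist_nonneg⟩ ⟨a, ha, b, hb, rfl⟩

lemma dist_le_of_mem_cubes {n : ℕ} {c c' a b : Fin n → ℝ} {L L' : ℝ} (ha : a ∈ Cube c L)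
    (hb : b ∈ Cube c' L') : dist a b ≤ L + L' + sdist (Cube c L) (Cube c' L') := by
  have h : dist a b - L - L' ≤ sdist (Cube c L) (Cube c' L') := by
    refine le_csInf ⟨_, a, ha, b, hb, rfl⟩ ?_
    rintro _ ⟨p, hp, q, hq, rfl⟩
    linarith [dist_le_of_mem_cube ha hp, dist_le_of_mem_cube hq hb, dist_triangle4 a p q b]
  linarith

/-- A non-decreasing doubling function `f` satisfies
`D ^ α * f D ≤ 8 ^ α * A ^ 3 * (r ^ α * f r)` whenever `D ≤ 8 * r`. -/
lemma rpow_mul_le_of_doubling {f : ℝ → ℝ} {A α D r : ℝ} (hα : 0 < α) (hA : 0 ≤ A)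
    (hpos : ∀ r, 0 < r → 0 < f r) (hmono : ∀ r r', 0 < r → r ≤ r' → f r ≤ f r')
    (hdbl : ∀ r, 0 < r → f (2 * r) ≤ A * f r) (hD : 0 < D) (hr : 0 < r) (hDr : D ≤ 8 * r) :
    D ^ α * f D ≤ 8 ^ α * A ^ 3 * (r ^ α * f r) := by
  have h1 : f D ≤ A ^ 3 * f r := by
    calc f D ≤ f (2 * (2 * (2 * r))) := hmono _ _ hD (by linarith)
      _ ≤ A * f (2 * (2 * r)) := hdbl _ (by positivity)
      _ ≤ A * (A * f (2 * r)) := by gcongr; exact hdbl _ (by positivity)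
      _ ≤ A * (A * (A * f r)) := by gcongr; exact hdbl _ hr
      _ = A ^ 3 * f r := by ring
  have h2 : D ^ α ≤ 8 ^ α * r ^ α := by
    rw [← Real.mul_rpow (by norm_num) hr.le]
    exact Real.rpow_le_rpow hD.le hDr hα.le
  calc D ^ α * f D ≤ (8 ^ α * r ^ α) * (A ^ 3 * f r) :=
        mul_le_mul h2 h1 (hpos D hD).le (by positivity)
    _ = 8 ^ α * A ^ 3 * (r ^ α * f r) := by ring

/-- If `ℓ(Q) < ℓ(R)`, `(x,t) ∈ W_R` and `y ∈ Q`, then the Hölder estimate for the kernel gives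
`|s_t(x,y) − s_t(x,c_Q)| ≲ ℓ(Q)^{α/2} ℓ(R)^{α/2} / (D(Q,R)^α sup_{z ∈ Q ∪ R} λ(z, D(Q,R)))`,
where `D(Q,R) = ℓ(Q) + ℓ(R) + d(Q,R)`. -/
theorem kernel_holder_estimate_small_cube
    (n : ℕ) (hn : 0 < n) (α Clam Cs Csym : ℝ)
    (hα : 0 < α) (hClam : 1 ≤ Clam) (hCs : 0 < Cs) (hCsym : 1 ≤ Csym) :
    ∃ C : ℝ, 0 < C ∧
      ∀ (μ : Measure (Fin n → ℝ)) (lam : (Fin n → ℝ) → ℝ → ℝ)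
        (s : ℝ → (Fin n → ℝ) → (Fin n → ℝ) → ℝ),
        (∀ x r, 0 < r → 0 < lam x r) →
        (∀ x r r', 0 < r → r ≤ r' → lam x r ≤ lam x r') →
        (∀ x r, 0 < r → lam x (2 * r) ≤ Clam * lam x r) →
        (∀ x r, 0 < r → μ (Metric.ball x r) ≤ ENNReal.ofReal (lam x r)) →
        (∀ x y r, 0 < r → dist x y ≤ r → lam x r ≤ Csym * lam y r) →
        (∀ t x y z, 0 < t → dist y z < t / 2 →
          |s t x y - s t x z| ≤
            Cs * dist y z ^ α / (t ^ α * lam x t + dist x y ^ α * lam x (dist x y))) →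
        ∀ (cQ : Fin n → ℝ) (LQ : ℝ) (cR : Fin n → ℝ) (LR : ℝ),
          0 < LQ → 0 < LR → LQ < LR →
          ∀ x ∈ Cube cR LR, ∀ t : ℝ, LR / 2 < t → t < LR → ∀ y ∈ Cube cQ LQ,
            |s t x y - s t x cQ| ≤
              C * (LQ ^ (α / 2) * LR ^ (α / 2)) /
                ((LQ + LR + sdist (Cube cQ LQ) (Cube cR LR)) ^ α *
                  ⨆ z : (Cube cQ LQ ∪ Cube cR LR : Set (Fin n → ℝ)),
                    lam z (LQ + LR + sdist (Cube cQ LQ) (Cube cR LR))) := by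
  refine ⟨2 * (Cs * (Csym * (8 ^ α * Clam ^ 3))), by positivity, ?_⟩
  intro μ lam s hpos hmono hdbl _ hsym hs cQ LQ cR LR hLQ hLR hlt x hx t ht ht' y hy
  set D := LQ + LR + sdist (Cube cQ LQ) (Cube cR LR) with hDdef
  set S := ⨆ z : (Cube cQ LQ ∪ Cube cR LR : Set (Fin n → ℝ)), lam z D with hS
  have hd0 := sdist_nonneg (Cube cQ LQ) (Cube cR LR)
  have hD : 0 < D := by linarith
  have ht0 : 0 < t := by linarith
  have hle : ∀ z : (Cube cQ LQ ∪ Cube cR LR : Set (Fin n → ℝ)), lam z D ≤ Csym * lam x D := by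
    rintro ⟨z, hz | hz⟩
    · exact hsym z x D hD (dist_le_of_mem_cubes hz hx)
    · exact hsym z x D hD (by linarith [dist_le_of_mem_cube hz hx])
  have : Nonempty (Cube cQ LQ ∪ Cube cR LR : Set (Fin n → ℝ)) := ⟨⟨x, Or.inr hx⟩⟩
  have hSle : S ≤ Csym * lam x D := ciSup_le hle
  have hSpos : 0 < S :=
    (hpos x D hD).trans_le <| le_ciSup (f := fun z : (Cube cQ LQ ∪ Cube cR LR :
      Set (Fin n → ℝ)) => lam z D) ⟨_, by rintro _ ⟨z, rfl⟩; exact hle z⟩ ⟨x, Or.inr hx⟩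
  have hDα : 0 < D ^ α := Real.rpow_pos_of_pos hD α
  have key : ∀ w ∈ Cube cQ LQ, ∀ v, dist w v ≤ LQ / 4 → |s t x w - s t x v| ≤
      Cs * (Csym * (8 ^ α * Clam ^ 3)) * (LQ ^ (α / 2) * LR ^ (α / 2)) / (D ^ α * S) := by
    intro w hw v hwv
    refine (hs t x w v ht0 (by linarith)).trans ?_
    have hnum : dist w v ^ α ≤ LQ ^ (α / 2) * LR ^ (α / 2) := by
      calc dist w v ^ α ≤ LQ ^ α := Real.rpow_le_rpow dist_nonneg (by linarith) hα.le
        _ = LQ ^ (α / 2) * LQ ^ (α / 2) := by rw [← Real.rpow_add hLQ, add_halves]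
        _ ≤ LQ ^ (α / 2) * LR ^ (α / 2) := by gcongr
    have hDle : D ≤ 4 * t + dist x w := by
      linarith [sdist_le_dist hw hx, dist_comm x w]
    have hnear : 0 < t ^ α * lam x t := mul_pos (Real.rpow_pos_of_pos ht0 α) (hpos x t ht0)
    have hfar : 0 ≤ dist x w ^ α * lam x (dist x w) := by
      rcases (dist_nonneg (x := x) (y := w)).eq_or_lt with h | h
      · rw [← h, Real.zero_rpow hα.ne', zero_mul]
      · exact mul_nonneg (Real.rpow_nonneg h.le α) (hpos x _ h).le
    have hden : D ^ α * lam x D ≤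
        8 ^ α * Clam ^ 3 * (t ^ α * lam x t + dist x w ^ α * lam x (dist x w)) := by
      have hscale : ∀ r, 0 < r → D ≤ 8 * r →
          D ^ α * lam x D ≤ 8 ^ α * Clam ^ 3 * (r ^ α * lam x r) := fun r hr hDr =>
        rpow_mul_le_of_doubling hα (by linarith) (hpos x) (hmono x) (hdbl x) hD hr hDr
      rcases le_total (dist x w) t with h | h
      · refine (hscale t ht0 (by linarith)).trans ?_
        gcongr
        linarith
      · refine (hscale (dist x w) (by linarith) (by linarith)).trans ?_
        gcongr
        linarith
    have hDS : D ^ α * S ≤ Csym * (8 ^ α * Clam ^ 3) *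
        (t ^ α * lam x t + dist x w ^ α * lam x (dist x w)) := by
      calc D ^ α * S ≤ D ^ α * (Csym * lam x D) := by gcongr
        _ = Csym * (D ^ α * lam x D) := by ring
        _ ≤ Csym * (8 ^ α * Clam ^ 3 *
            (t ^ α * lam x t + dist x w ^ α * lam x (dist x w))) := by gcongr
        _ = _ := by ring
    rw [div_le_div_iff₀ (by linarith) (mul_pos hDα hSpos)]
    calc Cs * dist w v ^ α * (D ^ α * S)
        ≤ Cs * (LQ ^ (α / 2) * LR ^ (α / 2)) * (Csym * (8 ^ α * Clam ^ 3) *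
          (t ^ α * lam x t + dist x w ^ α * lam x (dist x w))) := by gcongr
      _ = _ := by ring
  -- The estimate is chained through the midpoint, since `dist y cQ < t / 2` may fail.
  have hyc : dist y cQ ≤ LQ / 2 := hy
  have h1 : dist y (midpoint ℝ y cQ) ≤ LQ / 4 := by
    rw [dist_left_midpoint]; norm_num; linarith
  have h2 : dist (midpoint ℝ y cQ) cQ ≤ LQ / 4 := by
    rw [dist_midpoint_right]; norm_num; linarith
  have hm : midpoint ℝ y cQ ∈ Cube cQ LQ := Metric.mem_closedBall.2 (by linarith)
  calc |s t x y - s t x cQ|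
      ≤ |s t x y - s t x (midpoint ℝ y cQ)| + |s t x (midpoint ℝ y cQ) - s t x cQ| :=
        abs_sub_le _ _ _
    _ ≤ _ := add_le_add (key y hy _ h1) (key _ hm _ h2)
    _ = _ := by ring
end
end

section
/- Let α > 0, r ∈ ℕ, s ∈ ℤ, and let (c_S)_{S ∈ 𝒟} be a family of nonnegative reals indexed by the dyadic cubes of a grid 𝒟. Then Σ_{R ∈ 𝒟, ℓ(R) < 2^{s−r}} μ(R) · [ Σ_{k=r+1}^{s+gen(R)} 2^{−αk/2} μ(R^{(k−1)})^{−1/2} c_{R^{(k)}} ]² ≲ Σ_{S ∈ 𝒟, ℓ(S) ≤ 2^s} c_S², where gen(R) is defined by ℓ(R) = 2^{−gen(R)}, R^{(k)} is the k-th dyadic ancestor of R, terms with μ(R^{(k−1)}) = 0 are interpreted as 0, and the implied constant depends only on α and r. -/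
open MeasureTheory Set
open scoped ENNReal

noncomputable section

/-- The standard (half-open) dyadic cube `2^{-k}([0,1)^n + m)` in `ℝⁿ`; its sidelength is
`2^{-k}` and its `k`-th dyadic ancestor is indexed by `(k' - k, ⌊m/2^k⌋)`. -/
def dcube (n : ℕ) (k : ℤ) (m : Fin n → ℤ) : Set (Fin n → ℝ) :=
  {x | ∀ i, (m i : ℝ) * (2:ℝ) ^ (-k) ≤ x i ∧ x i < ((m i : ℝ) + 1) * (2:ℝ) ^ (-k)}

lemma mem_dcube_iff_floor {n : ℕ} {k : ℤ} {m : Fin n → ℤ} {x : Fin n → ℝ} :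
    x ∈ dcube n k m ↔ ∀ i, ⌊x i * (2:ℝ) ^ k⌋ = m i := by
  have h2 : (0:ℝ) < (2:ℝ) ^ k := by positivity
  simp only [dcube, mem_ofPred_eq, Int.floor_eq_iff, zpow_neg, ← div_eq_mul_inv,
    div_le_iff₀ h2, lt_div_iff₀ h2]

lemma measurableSet_dcube (n : ℕ) (k : ℤ) (m : Fin n → ℤ) : MeasurableSet (dcube n k m) := by
  have : dcube n k m = ⋂ i, {x | (m i : ℝ) * (2:ℝ) ^ (-k) ≤ x i} ∩
      {x | x i < ((m i : ℝ) + 1) * (2:ℝ) ^ (-k)} := by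
    ext x
    simp [dcube]
  rw [this]
  exact MeasurableSet.iInter fun i =>
    (measurableSet_le measurable_const (measurable_pi_apply i)).inter
      (measurableSet_lt (measurable_pi_apply i) measurable_const)

/-- The index of the `j`-th dyadic ancestor of a dyadic cube. -/
def dyadicAncestor {n : ℕ} (j : ℕ) (p : ℤ × (Fin n → ℤ)) : ℤ × (Fin n → ℤ) :=
  (p.1 - j, fun i => p.2 i / 2 ^ j)

lemma dyadicAncestor_dyadicAncestor {n : ℕ} (j k : ℕ) (p : ℤ × (Fin n → ℤ)) :
    dyadicAncestor j (dyadicAncestor k p) = dyadicAncestor (k + j) p := by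
  ext i
  · simp only [dyadicAncestor]
    push_cast
    ring
  · simp only [dyadicAncestor]
    rw [Int.ediv_ediv_of_nonneg (by positivity), pow_add]

lemma dcube_subset_dyadicAncestor {n : ℕ} (j : ℕ) (p : ℤ × (Fin n → ℤ)) :
    dcube n p.1 p.2 ⊆ dcube n (dyadicAncestor j p).1 (dyadicAncestor j p).2 := by
  intro x hx
  rw [mem_dcube_iff_floor] at hx ⊢
  intro i
  have h : x i * (2:ℝ) ^ (p.1 - (j : ℤ)) = x i * (2:ℝ) ^ p.1 / ((2 ^ j : ℕ) : ℝ) := by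
    rw [zpow_sub₀ (by norm_num), zpow_natCast]
    push_cast
    ring
  simp only [dyadicAncestor]
  rw [h, Int.floor_div_natCast, hx i]
  push_cast
  rfl

/-- The descendants of fixed generation of a dyadic cube have total measure at most that of the
cube. -/
lemma tsum_measure_dyadicAncestor_eq_le {n : ℕ} (μ : Measure (Fin n → ℝ)) (j : ℕ)
    (q : ℤ × (Fin n → ℤ)) :
    ∑' p : ℤ × (Fin n → ℤ), (if dyadicAncestor j p = q then μ (dcube n p.1 p.2) else 0)
      ≤ μ (dcube n q.1 q.2) := by
  classical
  set A : ℤ × (Fin n → ℤ) → Set (Fin n → ℝ) := fun p =>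
    if dyadicAncestor j p = q then dcube n p.1 p.2 else ∅ with hA
  have hAm : ∀ p, μ (A p) = if dyadicAncestor j p = q then μ (dcube n p.1 p.2) else 0 := by
    intro p
    simp only [hA]
    split_ifs <;> simp
  have hmem : ∀ p x, x ∈ A p → dyadicAncestor j p = q ∧ x ∈ dcube n p.1 p.2 := by
    intro p x hx
    simp only [hA] at hx
    split_ifs at hx with h
    · exact ⟨h, hx⟩
    · simp at hx
  simp only [← hAm]
  refine (tsum_meas_le_meas_iUnion_of_disjoint μ (fun p => ?_) fun p p' hpp' => ?_).trans
    (measure_mono (iUnion_subset fun p x hx => ?_))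
  · simp only [hA]
    split_ifs
    exacts [measurableSet_dcube _ _ _, MeasurableSet.empty]
  · refine Set.disjoint_left.2 fun x hx hx' => hpp' ?_
    obtain ⟨h, hx⟩ := hmem p x hx
    obtain ⟨h', hx'⟩ := hmem p' x hx'
    have h1 : p.1 = p'.1 := by
      have := congrArg Prod.fst (h.trans h'.symm)
      simpa [dyadicAncestor] using this
    rw [mem_dcube_iff_floor] at hx hx'
    refine Prod.ext h1 (funext fun i => ?_)
    rw [← hx i, ← hx' i, h1]
  · obtain ⟨rfl, hx'⟩ := hmem p x hx
    exact dcube_subset_dyadicAncestor j p hx'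

lemma tsum_measure_mul_dyadicAncestor_le {n : ℕ} (μ : Measure (Fin n → ℝ)) (j : ℕ)
    (f : ℤ × (Fin n → ℤ) → ℝ≥0∞) :
    ∑' p : ℤ × (Fin n → ℤ), μ (dcube n p.1 p.2) * f (dyadicAncestor j p)
      ≤ ∑' q : ℤ × (Fin n → ℤ), μ (dcube n q.1 q.2) * f q := by
  classical
  calc
    _ = ∑' p : ℤ × (Fin n → ℤ), ∑' q : ℤ × (Fin n → ℤ),
          (if dyadicAncestor j p = q then μ (dcube n p.1 p.2) else 0) * f q := by
      refine tsum_congr fun p => ?_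
      rw [tsum_eq_single (dyadicAncestor j p) fun q hq => by rw [if_neg hq.symm, zero_mul],
        if_pos rfl]
    _ = ∑' q : ℤ × (Fin n → ℤ), (∑' p : ℤ × (Fin n → ℤ),
          if dyadicAncestor j p = q then μ (dcube n p.1 p.2) else 0) * f q := by
      rw [ENNReal.tsum_comm]
      simp only [ENNReal.tsum_mul_right]
    _ ≤ _ := ENNReal.tsum_le_tsum fun q => by
      gcongr
      exact tsum_measure_dyadicAncestor_eq_le μ j q

/-- A dyadic cube has at most `2 ^ n` children. -/
lemma tsum_dyadicAncestor_one_le {n : ℕ} (f : ℤ × (Fin n → ℤ) → ℝ≥0∞) :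
    ∑' p : ℤ × (Fin n → ℤ), f (dyadicAncestor 1 p) ≤ 2 ^ n * ∑' q, f q := by
  let φ : ℤ × (Fin n → ℤ) → (Fin n → Bool) × (ℤ × (Fin n → ℤ)) :=
    fun p => (fun i => decide (p.2 i % 2 = 0), dyadicAncestor 1 p)
  have hφ : Function.Injective φ := by
    intro p p' h
    simp only [φ, Prod.mk.injEq, dyadicAncestor, funext_iff, decide_eq_decide] at h
    obtain ⟨h1, h2, h3⟩ := h
    refine Prod.ext (by omega) (funext fun i => ?_)
    have := h1 i
    have := h3 i
    omega
  calc
    _ = ∑' p, (fun x : (Fin n → Bool) × (ℤ × (Fin n → ℤ)) => f x.2) (φ p) := rfl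
    _ ≤ ∑' x : (Fin n → Bool) × (ℤ × (Fin n → ℤ)), f x.2 :=
      ENNReal.tsum_comp_le_tsum_of_injective hφ _
    _ = _ := by
      rw [ENNReal.tsum_prod']
      simp [tsum_fintype]

lemma mul_ofReal_toReal_rpow_neg_half_sq_le_one (a : ℝ≥0∞) :
    a * ENNReal.ofReal ((a.toReal ^ (-(1:ℝ) / 2)) ^ 2) ≤ 1 := by
  rcases eq_or_ne a ⊤ with rfl | ha
  · simp [Real.zero_rpow]
  rcases eq_or_ne a 0 with rfl | h0
  · simp
  have hpos : 0 < a.toReal := ENNReal.toReal_pos h0 ha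
  have h : (a.toReal ^ (-(1:ℝ) / 2)) ^ 2 = a.toReal⁻¹ := by
    rw [← Real.rpow_natCast, ← Real.rpow_mul hpos.le, ← Real.rpow_neg_one]
    norm_num
  rw [h, ENNReal.ofReal_inv_of_pos hpos, ENNReal.ofReal_toReal ha, ENNReal.mul_inv_cancel h0 ha]

/-- Summing over cubes the averaged coefficients of the parents of their `j`-th ancestors. -/
lemma tsum_measure_mul_normalized_le {n : ℕ} (μ : Measure (Fin n → ℝ)) (j : ℕ)
    (f : ℤ × (Fin n → ℤ) → ℝ≥0∞) :
    ∑' p : ℤ × (Fin n → ℤ), μ (dcube n p.1 p.2) *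
        (ENNReal.ofReal (((μ (dcube n (dyadicAncestor j p).1 (dyadicAncestor j p).2)).toReal ^
          (-(1:ℝ) / 2)) ^ 2) * f (dyadicAncestor 1 (dyadicAncestor j p)))
      ≤ 2 ^ n * ∑' q, f q := by
  refine (tsum_measure_mul_dyadicAncestor_le μ j fun q =>
    ENNReal.ofReal (((μ (dcube n q.1 q.2)).toReal ^ (-(1:ℝ) / 2)) ^ 2) *
      f (dyadicAncestor 1 q)).trans
    ((ENNReal.tsum_le_tsum fun q => ?_).trans (tsum_dyadicAncestor_one_le f))
  rw [← mul_assoc]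
  exact mul_le_of_le_one_left' (mul_ofReal_toReal_rpow_neg_half_sq_le_one _)

/-- Weighted Cauchy-Schwarz inequality with summable weights. -/
lemma ofReal_sum_mul_sq_le {ι : Type*} {w : ι → ℝ} (hw : ∀ k, 0 ≤ w k) (hs : Summable w)
    (t : Finset ι) (a : ι → ℝ) :
    ENNReal.ofReal ((∑ k ∈ t, w k * a k) ^ 2)
      ≤ ENNReal.ofReal (∑' k, w k) * ∑ k ∈ t, ENNReal.ofReal (w k) * ENNReal.ofReal (a k ^ 2) := by
  have hnn : ∀ k, 0 ≤ w k * a k ^ 2 := fun k => mul_nonneg (hw k) (sq_nonneg _)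
  calc
    _ ≤ ENNReal.ofReal ((∑' k, w k) * ∑ k ∈ t, w k * a k ^ 2) := by
      refine ENNReal.ofReal_le_ofReal ?_
      refine (Finset.sum_sq_le_sum_mul_sum_of_sq_le_mul t (fun k _ => hw k) (fun k _ => hnn k)
        fun k _ => (by ring : (w k * a k) ^ 2 = w k * (w k * a k ^ 2)).le).trans ?_
      exact mul_le_mul_of_nonneg_right (hs.sum_le_tsum t fun k _ => hw k)
        (Finset.sum_nonneg fun k _ => hnn k)
    _ = _ := by
      rw [ENNReal.ofReal_mul (tsum_nonneg hw), ENNReal.ofReal_sum_of_nonneg fun k _ => hnn k]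
      simp only [ENNReal.ofReal_mul (hw _)]

lemma summable_two_rpow_neg_mul_half {α : ℝ} (hα : 0 < α) :
    Summable fun k : ℕ => (2:ℝ) ^ (-(α * (k : ℝ)) / 2) := by
  have h : ∀ k : ℕ, (2:ℝ) ^ (-(α * (k : ℝ)) / 2) = ((2:ℝ) ^ (-α / 2)) ^ k := by
    intro k
    rw [← Real.rpow_natCast, ← Real.rpow_mul (by norm_num)]
    congr 1
    ring
  simp only [h]
  exact summable_geometric_of_lt_one (by positivity)
    (Real.rpow_lt_one_of_one_lt_of_neg (by norm_num) (by linarith))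

/-- **The final summing estimate.** For nonnegative coefficients `(c_S)` indexed by the
dyadic cubes,
`Σ_{ℓ(R) < 2^{s−r}} μ(R) [Σ_{k=r+1}^{s+gen(R)} 2^{−αk/2} μ(R^{(k−1)})^{−1/2} c_{R^{(k)}}]²
  ≲ Σ_{ℓ(S) ≤ 2^s} c_S²`,
where `R^{(k)}` is the `k`-th dyadic ancestor of `R`, terms with `μ(R^{(k−1)}) = 0` are
interpreted as `0`, and the constant depends only on `α` and `r`. -/
theorem geometric_summing_estimate
    (n : ℕ) (hn : 0 < n) (α : ℝ) (hα : 0 < α) (r : ℕ) :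
    ∃ C : ℝ, 0 < C ∧
      ∀ (μ : Measure (Fin n → ℝ)), IsFiniteMeasureOnCompacts μ →
      ∀ (c : ℤ × (Fin n → ℤ) → ℝ), (∀ p, 0 ≤ c p) → ∀ s : ℤ,
        (∑' p : ℤ × (Fin n → ℤ),
          if (r : ℤ) - s < p.1 then
            μ (dcube n p.1 p.2) *
              ENNReal.ofReal
                ((∑ k ∈ Finset.Icc (r + 1) (s + p.1).toNat,
                  (2:ℝ) ^ (-(α * (k : ℝ)) / 2) *
                    (μ (dcube n (p.1 - ((k : ℤ) - 1))
                        (fun i => p.2 i / 2 ^ (k - 1)))).toReal ^ (-(1:ℝ) / 2) *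
                    c (p.1 - (k : ℤ), fun i => p.2 i / 2 ^ k)) ^ 2)
          else 0)
        ≤ ENNReal.ofReal C *
            ∑' q : ℤ × (Fin n → ℤ), (if -s ≤ q.1 then ENNReal.ofReal (c q ^ 2) else 0) := by
  have hs := summable_two_rpow_neg_mul_half hα
  set w : ℕ → ℝ := fun k => (2:ℝ) ^ (-(α * (k : ℝ)) / 2) with hw_def
  have hw : ∀ k, 0 ≤ w k := fun k => by simp only [hw_def]; positivity
  have hG : 0 < ∑' k, w k := hs.tsum_pos hw 0 (by simp only [hw_def]; positivity)
  refine ⟨(∑' k, w k) * ((∑' k, w k) * 2 ^ n), by positivity, fun μ _ c _ s => ?_⟩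
  set f : ℤ × (Fin n → ℤ) → ℝ≥0∞ := fun q => if -s ≤ q.1 then ENNReal.ofReal (c q ^ 2) else 0
  let F : ℕ → ℤ × (Fin n → ℤ) → ℝ≥0∞ := fun k p => μ (dcube n p.1 p.2) *
    (ENNReal.ofReal (((μ (dcube n (dyadicAncestor (k - 1) p).1
      (dyadicAncestor (k - 1) p).2)).toReal ^ (-(1:ℝ) / 2)) ^ 2) *
      f (dyadicAncestor 1 (dyadicAncestor (k - 1) p)))
  calc
    _ ≤ ∑' p, ENNReal.ofReal (∑' k, w k) * ∑' k, ENNReal.ofReal (w k) * F k p := by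
      refine ENNReal.tsum_le_tsum fun p => ?_
      split_ifs with hp
      · simp only [mul_assoc]
        refine (mul_le_mul_right (ofReal_sum_mul_sq_le hw hs _ _) _).trans ?_
        rw [mul_left_comm, Finset.mul_sum]
        gcongr
        refine le_trans (Finset.sum_le_sum fun k hk => ?_) (ENNReal.sum_le_tsum _)
        obtain ⟨hk1, hk2⟩ := Finset.mem_Icc.1 hk
        have hk' : k - 1 + 1 = k := by omega
        have hcast : ((k - 1 : ℕ) : ℤ) = (k : ℤ) - 1 := by omega
        have hfk : f (dyadicAncestor k p) = ENNReal.ofReal (c (dyadicAncestor k p) ^ 2) :=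
          if_pos (show -s ≤ p.1 - (k : ℤ) by omega)
        simp only [F, dyadicAncestor_dyadicAncestor, hk', hfk]
        simp only [dyadicAncestor, hcast]
        rw [mul_pow, ENNReal.ofReal_mul (sq_nonneg _), mul_left_comm]
      · exact zero_le
    _ = ENNReal.ofReal (∑' k, w k) * ∑' k, ENNReal.ofReal (w k) * ∑' p, F k p := by
      rw [ENNReal.tsum_mul_left, ENNReal.tsum_comm]
      simp only [ENNReal.tsum_mul_left]
    _ ≤ ENNReal.ofReal (∑' k, w k) * ∑' k, ENNReal.ofReal (w k) * (2 ^ n * ∑' q, f q) := by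
      gcongr with k
      exact tsum_measure_mul_normalized_le μ (k - 1) f
    _ = _ := by
      rw [ENNReal.tsum_mul_right, ← ENNReal.ofReal_tsum_of_nonneg hw hs,
        ENNReal.ofReal_mul hG.le, ENNReal.ofReal_mul hG.le, ENNReal.ofReal_pow (by norm_num)]
      simp only [ENNReal.ofReal_ofNat, mul_assoc]
end
end
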